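/- arXiv:2005.03338 — 4 statements merged into one kernel-verified Lean document; each statement's English description precedes it below -/
import Mathlib

section
/- Assume 0 < λ ≤ Λ and that φ satisfies the Osgood condition (φ_A). Let r* > 0 and M > 0. Then there exist constants m and μ with 0 < m ≤ M, where m depends only on λ, Λ, n, φ, r* and μ depends only on λ, Λ, n, φ, r*, M, such that for every y ∈ ℝⁿ and every 0 < r ≤ r* there is a C² function ǔ on the annulus A = B(y,2r) ∖ closure(B(y,r)), continuous up to the closure of A, satisfying ǔ = 0 on ∂B(y,r), ǔ = −m·r on ∂B(y,2r), and μ ≤ |Dǔ(x)| ≤ μ⁻¹ for all x ∈ A, such that: (i) ǔ is a strict classical subsolution in A of F(x,u,Du,D²u) = 0 for every F satisfying (F1) and (F2B) with these λ, Λ, φ; and (ii) −ǔ is a strict classical supersolution in A of F(x,u,Du,D²u) = 0 for every F satisfying (F1) and (F2A) with these λ, Λ, φ. -/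
open Metric Set Filter MeasureTheory
open scoped Topology RealInnerProductSpace Classical

noncomputable section

/-- Euclidean space `ℝⁿ`. -/
abbrev Eucl (n : ℕ) := EuclideanSpace ℝ (Fin n)

/-- Real `n × n` matrices. -/
abbrev Mat (n : ℕ) := Matrix (Fin n) (Fin n) ℝ

variable {n : ℕ}

/-- Eigenvalues of a matrix (junk value `0` if the matrix is not symmetric). -/
noncomputable def eigenvals (X : Mat n) : Fin n → ℝ :=
  if h : X.IsHermitian then h.eigenvalues else 0

/-- The Pucci maximal operator `P⁺_{λ,Λ}(X) = -λ Σ_{eᵢ ≥ 0} eᵢ - Λ Σ_{eᵢ < 0} eᵢ`. -/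
noncomputable def pucciPlus (lam Lam : ℝ) (X : Mat n) : ℝ :=
  ∑ i, (if 0 ≤ eigenvals X i then -(lam * eigenvals X i) else -(Lam * eigenvals X i))

/-- The Pucci minimal operator `P⁻_{λ,Λ}(X) = -Λ Σ_{eᵢ ≥ 0} eᵢ - λ Σ_{eᵢ < 0} eᵢ`. -/
noncomputable def pucciMinus (lam Lam : ℝ) (X : Mat n) : ℝ :=
  ∑ i, (if 0 ≤ eigenvals X i then -(Lam * eigenvals X i) else -(lam * eigenvals X i))

/-- The positive semidefinite order `X ≤ Y` on symmetric matrices. -/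
def matLE (X Y : Mat n) : Prop := (Y - X).PosSemidef

/-- Structure condition (F1): `F(x,u,p,X) ≥ F(x,v,p,Y)` whenever `u ≥ v` and `X ≤ Y`. -/
def CondF1 (F : Eucl n → ℝ → Eucl n → Mat n → ℝ) : Prop :=
  ∀ x u v p X Y, v ≤ u → matLE X Y → F x v p Y ≤ F x u p X

/-- Structure condition (F2A): `-F(x,0,p,X) ≤ φ(|p|) - P⁻_{λ,Λ}(X)`. -/
def CondF2A (lam Lam : ℝ) (φ : ℝ → ℝ) (F : Eucl n → ℝ → Eucl n → Mat n → ℝ) : Prop :=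
  ∀ x p X, X.IsHermitian → -F x 0 p X ≤ φ ‖p‖ - pucciMinus lam Lam X

/-- Structure condition (F2B): `F(x,0,p,X) ≤ φ(|p|) + P⁺_{λ,Λ}(X)`. -/
def CondF2B (lam Lam : ℝ) (φ : ℝ → ℝ) (F : Eucl n → ℝ → Eucl n → Mat n → ℝ) : Prop :=
  ∀ x p X, X.IsHermitian → F x 0 p X ≤ φ ‖p‖ + pucciPlus lam Lam X

/-- Structure condition (F2B*): `F(x,r,p,X) ≤ φ(|p|) + P⁺_{λ,Λ}(X) + γ(r)` for `r > 0`. -/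
def CondF2Bstar (lam Lam : ℝ) (φ γF : ℝ → ℝ) (F : Eucl n → ℝ → Eucl n → Mat n → ℝ) : Prop :=
  ∀ x (r : ℝ) p X, 0 < r → X.IsHermitian →
    F x r p X ≤ φ ‖p‖ + pucciPlus lam Lam X + γF r

/-- `γ` is nonnegative and dominated by `φ`: `γ(r) ≤ C* φ(r)` whenever `0 < r ≤ 1`. -/
def GammaDominated (Cstar : ℝ) (φ γF : ℝ → ℝ) : Prop :=
  (∀ r : ℝ, 0 < r → 0 ≤ γF r) ∧ ∀ r : ℝ, 0 < r → r ≤ 1 → γF r ≤ Cstar * φ r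

/-- Standing assumptions on `φ : [0,∞) → [0,∞)`: continuous, strictly increasing and
`φ(t) ≥ t`. -/
def PhiAdmissible (φ : ℝ → ℝ) : Prop :=
  ContinuousOn φ (Ici 0) ∧ StrictMonoOn φ (Ici 0) ∧ ∀ t : ℝ, 0 ≤ t → t ≤ φ t

/-- The Osgood condition (φ_A): `∫₀¹ dt / φ(t) = ∞`, as divergence of the improper
Riemann integral. -/
def OsgoodCondition (φ : ℝ → ℝ) : Prop :=
  Tendsto (fun ε : ℝ => ∫ t in ε..1, 1 / φ t) (𝓝[>] 0) atTop

/-- Condition (φ_B): for every sufficiently small `ε > 0`, `∫₀^ε f_ν(t) dt → ∞` as `ν → ∞`,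
where `f_ν` solves `f' = -φ(f)`, `f(0) = ν`. -/
def CondPhiB (φ : ℝ → ℝ) : Prop :=
  ∃ ε₀ > (0:ℝ), ∀ ε : ℝ, 0 < ε → ε ≤ ε₀ → ∀ M : ℝ, 0 < M → ∃ ν₀ > (0:ℝ), ∀ ν : ℝ, ν₀ ≤ ν →
    ∀ f : ℝ → ℝ, (∀ t ∈ Icc (0:ℝ) ε, 0 ≤ f t) → f 0 = ν →
      (∀ t ∈ Icc (0:ℝ) ε, HasDerivAt f (-φ (f t)) t) →
      M ≤ ∫ t in (0:ℝ)..ε, f t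

/-- The Hessian matrix of a real valued function on Euclidean space. -/
noncomputable def hess (ψ : Eucl n → ℝ) (x : Eucl n) : Mat n :=
  Matrix.of fun i j =>
    iteratedFDeriv ℝ 2 ψ x ![EuclideanSpace.single i 1, EuclideanSpace.single j 1]

/-- Viscosity subsolution of `F(x,u,Du,D²u) = 0` in the open set `Ω`. -/
def ViscositySubsolution (F : Eucl n → ℝ → Eucl n → Mat n → ℝ) (Ω : Set (Eucl n))
    (u : Eucl n → ℝ) : Prop :=
  ∀ ψ : Eucl n → ℝ, ContDiffOn ℝ 2 ψ Ω → ∀ x₀ ∈ Ω,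
    IsLocalMaxOn (fun x => u x - ψ x) Ω x₀ →
    F x₀ (u x₀) (gradient ψ x₀) (hess ψ x₀) ≤ 0

/-- Viscosity supersolution of `F(x,u,Du,D²u) = 0` in the open set `Ω`. -/
def ViscositySupersolution (F : Eucl n → ℝ → Eucl n → Mat n → ℝ) (Ω : Set (Eucl n))
    (v : Eucl n → ℝ) : Prop :=
  ∀ ψ : Eucl n → ℝ, ContDiffOn ℝ 2 ψ Ω → ∀ x₀ ∈ Ω,
    IsLocalMinOn (fun x => v x - ψ x) Ω x₀ →
    0 ≤ F x₀ (v x₀) (gradient ψ x₀) (hess ψ x₀)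

/-- Strict classical (twice differentiable) subsolution on an open set. -/
def StrictClassicalSubsolution (F : Eucl n → ℝ → Eucl n → Mat n → ℝ) (Ω : Set (Eucl n))
    (u : Eucl n → ℝ) : Prop :=
  ContDiffOn ℝ 2 u Ω ∧ ∀ x ∈ Ω, F x (u x) (gradient u x) (hess u x) < 0

/-- Strict classical (twice differentiable) supersolution on an open set. -/
def StrictClassicalSupersolution (F : Eucl n → ℝ → Eucl n → Mat n → ℝ) (Ω : Set (Eucl n))
    (v : Eucl n → ℝ) : Prop :=
  ContDiffOn ℝ 2 v Ω ∧ ∀ x ∈ Ω, 0 < F x (v x) (gradient v x) (hess v x)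

/-- The interior ball condition at a boundary point `w` with radius `ri`. -/
def InteriorBallAt (Ω : Set (Eucl n)) (w : Eucl n) (ri : ℝ) : Prop :=
  ∃ y, ball y ri ⊆ Ω ∧ sphere y ri ∩ frontier Ω = {w}

/-- The interior ball condition (for all boundary points). -/
def InteriorBallCondition (Ω : Set (Eucl n)) (ri : ℝ) : Prop :=
  ∀ w ∈ frontier Ω, InteriorBallAt Ω w ri

/-- The exterior ball condition at a boundary point `w` with radius `re`. -/
def ExteriorBallAt (Ω : Set (Eucl n)) (w : Eucl n) (re : ℝ) : Prop :=
  ∃ y, ball y re ⊆ Ωᶜ ∧ sphere y re ∩ frontier Ω = {w}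

/-- The exterior ball condition (for all boundary points). -/
def ExteriorBallCondition (Ω : Set (Eucl n)) (re : ℝ) : Prop :=
  ∀ w ∈ frontier Ω, ExteriorBallAt Ω w re

/-- The ball condition: both the interior and the exterior ball condition. -/
def BallCondition (Ω : Set (Eucl n)) (rb : ℝ) : Prop :=
  InteriorBallCondition Ω rb ∧ ExteriorBallCondition Ω rb

/-- The annulus `B(y,R) ∖ closure B(y,r)`. -/
def annulus (y : Eucl n) (r R : ℝ) : Set (Eucl n) := ball y R \ closedBall y r

/-- The Osgood integral of `1 / φ` diverges to `-∞` in the logarithmic variable. -/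
theorem OsgoodCondition.tendsto_integral_exp_div {φ : ℝ → ℝ} (hφ : PhiAdmissible φ)
    (hOsg : OsgoodCondition φ) :
    Tendsto (fun t : ℝ => ∫ v in (0:ℝ)..t, Real.exp (min v 0) / φ (Real.exp (min v 0)))
      atBot atBot := by
  have hlim := tendsto_neg_atTop_atBot.comp (hOsg.comp Real.tendsto_exp_atBot_nhdsGT)
  refine hlim.congr' ?_
  filter_upwards [eventually_le_atBot (0 : ℝ)] with t ht
  have hcont : ContinuousOn (fun s => 1 / φ s) (Real.exp '' uIcc t 0) := by
    refine continuousOn_const.div (hφ.1.mono ?_) ?_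
    · rintro _ ⟨v, -, rfl⟩
      exact (Real.exp_pos v).le
    · rintro _ ⟨v, -, rfl⟩
      exact ((Real.exp_pos v).trans_le (hφ.2.2 _ (Real.exp_pos v).le)).ne'
  have hsub := intervalIntegral.integral_comp_mul_deriv' (a := t) (b := 0)
    (fun v _ => Real.hasDerivAt_exp v) Real.continuous_exp.continuousOn hcont
  rw [Real.exp_zero] at hsub
  simp only [Function.comp_apply] at hsub ⊢
  rw [← hsub, ← intervalIntegral.integral_symm]
  refine intervalIntegral.integral_congr fun v hv => ?_
  rw [uIcc_of_ge ht] at hv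
  simp only [min_eq_left hv.2]
  ring

/-- Under the Osgood condition, the solution of `K' = -C φ(K)` with initial value `a ∈ (0, 1]`
stays positive for all positive times. -/
theorem OsgoodCondition.exists_pos_profile {φ : ℝ → ℝ} (hφ : PhiAdmissible φ)
    (hOsg : OsgoodCondition φ) {C a : ℝ} (hC : 0 < C) (ha : 0 < a) (ha1 : a ≤ 1) :
    ∃ K : ℝ → ℝ, ContDiff ℝ 1 K ∧ (∀ s, 0 < K s) ∧ Antitone K ∧ K 0 = a ∧
      ∀ s, 0 ≤ s → deriv K s = -(C * φ (K s)) := by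
  set q : ℝ → ℝ := fun v => Real.exp (min v 0) / φ (Real.exp (min v 0)) with hq
  have hφpos : ∀ v, 0 < φ (Real.exp v) := fun v =>
    (Real.exp_pos v).trans_le (hφ.2.2 _ (Real.exp_pos v).le)
  have hqpos : ∀ v, 0 < q v := fun v => div_pos (Real.exp_pos _) (hφpos _)
  have hqcont : Continuous q := by
    have hexp : Continuous fun v : ℝ => Real.exp (min v 0) := by fun_prop
    exact hexp.div (hφ.1.comp_continuous hexp fun v => (Real.exp_pos _).le)
      fun v => (hφpos _).ne'
  set L : ℝ → ℝ := fun t => ∫ v in (0:ℝ)..t, q v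
  have hLderiv : ∀ t, HasDerivAt L (q t) t := fun t =>
    (hqcont.integral_hasStrictDerivAt 0 t).hasDerivAt
  have hLmono : StrictMono L := strictMono_of_hasDerivAt_pos hLderiv hqpos
  have hLtop : Tendsto L atTop atTop := by
    have hlin : Tendsto (fun t : ℝ => t * q 0) atTop atTop :=
      tendsto_id.atTop_mul_const (hqpos 0)
    refine hlin.congr' ?_
    filter_upwards [eventually_ge_atTop (0 : ℝ)] with t ht
    have : L t = ∫ _ in (0:ℝ)..t, q 0 := by
      refine intervalIntegral.integral_congr fun v hv => ?_
      rw [uIcc_of_le ht] at hv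
      simp [hq, min_eq_right hv.1]
    rw [this]
    simp
  have hLsurj : Function.Surjective L :=
    (continuous_iff_continuousAt.2 fun t => (hLderiv t).continuousAt).surjective hLtop
      (hOsg.tendsto_integral_exp_div hφ)
  set G := hLmono.orderIsoOfSurjective L hLsurj
  have hLG : ∀ s, L (G.symm s) = s := fun s => G.apply_symm_apply s
  have hGderiv : ∀ s, HasDerivAt G.symm (q (G.symm s))⁻¹ s := fun s =>
    HasDerivAt.of_local_left_inverse G.symm.continuous.continuousAt (hLderiv _) (hqpos _).ne'
      (Eventually.of_forall hLG)
  set w : ℝ → ℝ := fun s => G.symm (L (Real.log a) - C * s) with hw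
  have hwderiv : ∀ s, HasDerivAt w ((q (w s))⁻¹ * -C) s := fun s => by
    have hin : HasDerivAt (fun s : ℝ => L (Real.log a) - C * s) (-C) s := by
      simpa using ((hasDerivAt_id s).const_mul C).const_sub (L (Real.log a))
    exact (hGderiv _).comp s hin
  have hwcont : Continuous w := continuous_iff_continuousAt.2 fun s => (hwderiv s).continuousAt
  have hw0 : w 0 = Real.log a := by
    simp only [hw, mul_zero, sub_zero]
    exact G.symm_apply_apply _
  have hwanti : Antitone w := fun s t hst =>
    G.symm.monotone (sub_le_sub_left (mul_le_mul_of_nonneg_left hst hC.le) _)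
  have hKderiv : ∀ s, HasDerivAt (fun s => Real.exp (w s))
      (Real.exp (w s) * ((q (w s))⁻¹ * -C)) s := fun s => (hwderiv s).exp
  refine ⟨fun s => Real.exp (w s), ?_, fun s => Real.exp_pos _,
    Real.exp_monotone.comp_antitone hwanti, by simp only [hw0, Real.exp_log ha], fun s hs => ?_⟩
  · rw [contDiff_one_iff_deriv]
    refine ⟨fun s => (hKderiv s).differentiableAt, ?_⟩
    rw [show deriv (fun s => Real.exp (w s)) = fun s => Real.exp (w s) * ((q (w s))⁻¹ * -C) from
      funext fun s => (hKderiv s).deriv]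
    exact (Real.continuous_exp.comp hwcont).mul
      (((hqcont.comp hwcont).inv₀ fun s => (hqpos _).ne').mul continuous_const)
  · have hws : w s ≤ 0 := (hwanti hs).trans (hw0 ▸ Real.log_nonpos ha.le ha1)
    rw [(hKderiv s).deriv]
    simp only [hq, min_eq_left hws]
    have := (Real.exp_pos (w s)).ne'
    field_simp

theorem exists_unit_vector_eigenvals {X : Mat n} (hX : X.IsHermitian) (i : Fin n) :
    ∃ v : Fin n → ℝ, v ⬝ᵥ v = 1 ∧ v ⬝ᵥ X.mulVec v = eigenvals X i := by
  refine ⟨(hX.eigenvectorBasis i).ofLp, ?_, ?_⟩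
  · have hnorm := EuclideanSpace.real_norm_sq_eq (hX.eigenvectorBasis i)
    rw [hX.eigenvectorBasis.orthonormal.1 i] at hnorm
    simp only [dotProduct, ← pow_two]
    linarith
  · have := hX.eigenvalues_eq i
    simp only [eigenvals, dif_pos hX, this, RCLike.re_to_real, star_trivial]

theorem trace_eq_sum_eigenvals {X : Mat n} (hX : X.IsHermitian) :
    X.trace = ∑ i, eigenvals X i := by
  simp only [eigenvals, dif_pos hX]
  exact hX.trace_eq_sum_eigenvalues

theorem pucciPlus_le {lam Lam b : ℝ} (hlamLam : lam ≤ Lam) (hb : 0 ≤ b) {X : Mat n}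
    (hX : X.IsHermitian) (hlow : ∀ v : Fin n → ℝ, -b * (v ⬝ᵥ v) ≤ v ⬝ᵥ X.mulVec v) :
    pucciPlus lam Lam X ≤ -(lam * X.trace) + n * ((Lam - lam) * b) := by
  have hterm : ∀ i, (if 0 ≤ eigenvals X i then -(lam * eigenvals X i)
      else -(Lam * eigenvals X i)) ≤ -(lam * eigenvals X i) + (Lam - lam) * b := fun i => by
    obtain ⟨v, hv, hvi⟩ := exists_unit_vector_eigenvals hX i
    have hi := hlow v
    rw [hv, hvi] at hi
    split_ifs
    · nlinarith
    · nlinarith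
  refine (Finset.sum_le_sum fun i _ => hterm i).trans (le_of_eq ?_)
  rw [Finset.sum_add_distrib, Finset.sum_neg_distrib, ← Finset.mul_sum,
    ← trace_eq_sum_eigenvals hX]
  simp

theorem le_pucciMinus_neg {lam Lam b : ℝ} (hlamLam : lam ≤ Lam) (hb : 0 ≤ b) {X : Mat n}
    (hX : X.IsHermitian) (hlow : ∀ v : Fin n → ℝ, -b * (v ⬝ᵥ v) ≤ v ⬝ᵥ X.mulVec v) :
    lam * X.trace - n * ((Lam - lam) * b) ≤ pucciMinus lam Lam (-X) := by
  have hterm : ∀ i, -(lam * eigenvals (-X) i) - (Lam - lam) * b ≤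
      (if 0 ≤ eigenvals (-X) i then -(Lam * eigenvals (-X) i)
        else -(lam * eigenvals (-X) i)) := fun i => by
    obtain ⟨v, hv, hvi⟩ := exists_unit_vector_eigenvals hX.neg i
    have hi := hlow v
    rw [Matrix.neg_mulVec, dotProduct_neg] at hvi
    rw [hv] at hi
    split_ifs
    · nlinarith
    · nlinarith
  refine le_trans (le_of_eq ?_) (Finset.sum_le_sum fun i _ => hterm i)
  rw [Finset.sum_sub_distrib, Finset.sum_neg_distrib, ← Finset.mul_sum,
    ← trace_eq_sum_eigenvals hX.neg]
  simp

/-- The gradient and the Hessian of `x ↦ c U(d |x - y|² - 1)` where `U' = K`. -/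
theorem radial_derivatives {U K : ℝ → ℝ} (hU : ∀ t, HasDerivAt U (K t) t)
    (hK : Differentiable ℝ K)
    (c d : ℝ) (y x : Eucl n) :
    gradient (fun z : Eucl n => c * U (d * ‖z - y‖ ^ 2 - 1)) x =
        (2 * c * d * K (d * ‖x - y‖ ^ 2 - 1)) • (x - y) ∧
      hess (fun z : Eucl n => c * U (d * ‖z - y‖ ^ 2 - 1)) x =
        (2 * c * d * K (d * ‖x - y‖ ^ 2 - 1)) • (1 : Mat n) +
          (4 * c * d ^ 2 * deriv K (d * ‖x - y‖ ^ 2 - 1)) •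
            Matrix.vecMulVec (x - y).ofLp (x - y).ofLp := by
  have harg : ∀ z : Eucl n, HasFDerivAt (fun z : Eucl n => d * ‖z - y‖ ^ 2 - 1)
      ((2 * d) • innerSL ℝ (z - y)) z := fun z => by
    have h := ((((hasFDerivAt_id z).sub_const y).norm_sq).const_mul d).sub_const (1 : ℝ)
    refine h.congr_fderiv ?_
    ext v
    simp
    ring
  have hfderiv : ∀ z : Eucl n, HasFDerivAt (fun z : Eucl n => c * U (d * ‖z - y‖ ^ 2 - 1))
      ((2 * c * d * K (d * ‖z - y‖ ^ 2 - 1)) • innerSL ℝ (z - y)) z := fun z => by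
    refine (((hU _).comp_hasFDerivAt z (harg z)).const_mul c).congr_fderiv ?_
    ext v
    simp
    ring
  refine ⟨HasGradientAt.gradient ?_, ?_⟩
  · rw [hasGradientAt_iff_hasFDerivAt]
    refine (hfderiv x).congr_fderiv ?_
    ext v
    simp
  · have hcoef : HasFDerivAt (fun z : Eucl n => 2 * c * d * K (d * ‖z - y‖ ^ 2 - 1))
        ((4 * c * d ^ 2 * deriv K (d * ‖x - y‖ ^ 2 - 1)) • innerSL ℝ (x - y)) x := by
      refine (((hK _).hasDerivAt.comp_hasFDerivAt x (harg x)).const_mul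
        (2 * c * d)).congr_fderiv ?_
      ext v
      simp
      ring
    have hlin : HasFDerivAt (fun z : Eucl n => innerSL ℝ (z - y))
        (innerSL ℝ : Eucl n →L[ℝ] _) x := by
      exact ((innerSL ℝ : Eucl n →L[ℝ] _).hasFDerivAt).comp x ((hasFDerivAt_id x).sub_const y)
    have hsecond := hcoef.smul hlin
    have hD : fderiv ℝ (fun z : Eucl n => c * U (d * ‖z - y‖ ^ 2 - 1)) =
        fun z => (2 * c * d * K (d * ‖z - y‖ ^ 2 - 1)) • innerSL ℝ (z - y) :=
      funext fun z => (hfderiv z).fderiv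
    have hinner : ∀ i j : Fin n, (innerSL ℝ : Eucl n →L[ℝ] _) (EuclideanSpace.single i 1)
        (EuclideanSpace.single j 1) = (1 : Mat n) i j := fun i j => by
      refine (EuclideanSpace.inner_single_left i (1 : ℝ) _).trans ?_
      simp [Matrix.one_apply]
    ext i j
    simp only [hess, Matrix.of_apply, iteratedFDeriv_two_apply, hD]
    rw [show fderiv ℝ (fun z => (2 * c * d * K (d * ‖z - y‖ ^ 2 - 1)) • innerSL ℝ (z - y)) x = _
      from hsecond.fderiv]
    simp [Matrix.vecMulVec_apply, EuclideanSpace.inner_single_right, hinner]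
    ring

theorem gradient_neg_fun (f : Eucl n → ℝ) (x : Eucl n) :
    gradient (fun z => -f z) x = -gradient f x := by
  simp [gradient, fderiv_fun_neg]

theorem hess_neg_fun (f : Eucl n → ℝ) (x : Eucl n) :
    hess (fun z => -f z) x = -hess f x := by
  ext i j
  have := iteratedFDeriv_neg_apply (𝕜 := ℝ) (i := 2) (f := f) (x := x)
  simp only [hess, Matrix.of_apply, Matrix.neg_apply]
  exact congrArg (fun T => T ![EuclideanSpace.single i 1, EuclideanSpace.single j 1]) this

/-- Lemma 3.1: arbitrarily flat strict classical barriers in an annulus. -/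
theorem barrier_flat_annulus
    {n : ℕ} (lam Lam : ℝ) (hlam : 0 < lam) (hlamLam : lam ≤ Lam)
    (φ : ℝ → ℝ) (hφ : PhiAdmissible φ) (hOsg : OsgoodCondition φ)
    (rstar M : ℝ) (hrstar : 0 < rstar) (hM : 0 < M) :
    ∃ m μ : ℝ, 0 < m ∧ m ≤ M ∧ 0 < μ ∧
      ∀ (y : Eucl n) (r : ℝ), 0 < r → r ≤ rstar →
        ∃ uc : Eucl n → ℝ,
          ContDiffOn ℝ 2 uc (annulus y r (2*r)) ∧
          ContinuousOn uc (closure (annulus y r (2*r))) ∧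
          (∀ x ∈ sphere y r, uc x = 0) ∧
          (∀ x ∈ sphere y (2*r), uc x = -(m*r)) ∧
          (∀ x ∈ annulus y r (2*r), μ ≤ ‖gradient uc x‖ ∧ ‖gradient uc x‖ ≤ μ⁻¹) ∧
          (∀ F : Eucl n → ℝ → Eucl n → Mat n → ℝ, CondF1 F → CondF2B lam Lam φ F →
            StrictClassicalSubsolution F (annulus y r (2*r)) uc) ∧
          (∀ F : Eucl n → ℝ → Eucl n → Mat n → ℝ, CondF1 F → CondF2A lam Lam φ F →
            StrictClassicalSupersolution F (annulus y r (2*r)) (fun x => -uc x)) := by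
  set C : ℝ := (rstar + Lam * n + 1) / lam with hC
  have hLam : 0 < Lam := hlam.trans_le hlamLam
  have hCpos : 0 < C := by positivity
  have hlamC : lam * C = rstar + Lam * n + 1 := by
    rw [hC]
    field_simp
  obtain ⟨K, hKsmooth, hKpos, hKanti, hK0, hKode⟩ :=
    hOsg.exists_pos_profile hφ hCpos (lt_min hM one_pos) (min_le_right M 1)
  have hKcont := hKsmooth.continuous
  set U : ℝ → ℝ := fun t => ∫ s in (0:ℝ)..t, K s with hUdef
  have hU : ∀ t, HasDerivAt U (K t) t := fun t =>
    (hKcont.integral_hasStrictDerivAt 0 t).hasDerivAt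
  have hUsmooth : ContDiff ℝ 2 U := by
    rw [show (2 : WithTop ℕ∞) = 1 + 1 from rfl, contDiff_succ_iff_deriv]
    refine ⟨fun t => (hU t).differentiableAt, by simp, ?_⟩
    rwa [show deriv U = K from funext fun t => (hU t).deriv]
  have hU3 : 0 < U 3 :=
    intervalIntegral.intervalIntegral_pos_of_pos (hKcont.intervalIntegrable _ _) hKpos (by norm_num)
  have hU3M : U 3 ≤ 3 * M := by
    have hle : U 3 ≤ ∫ _ in (0:ℝ)..3, M :=
      intervalIntegral.integral_mono_on (by norm_num) (hKcont.intervalIntegrable _ _)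
        intervalIntegrable_const fun s hs => (hKanti hs.1).trans (hK0 ▸ min_le_left M 1)
    simpa using hle
  have hUnonneg : ∀ t, 0 ≤ t → 0 ≤ U t := fun t ht =>
    intervalIntegral.integral_nonneg ht fun s _ => (hKpos s).le
  have hK1 : ∀ t, 0 ≤ t → K t ≤ 1 := fun t ht =>
    (hKanti ht).trans (hK0 ▸ min_le_right M 1)
  refine ⟨U 3 / 4, K 3 / 2, by positivity, by linarith, by linarith [hKpos 3], fun y r hr hrs => ?_⟩
  set uc : Eucl n → ℝ := fun z => -(r / 4) * U ((r ^ 2)⁻¹ * ‖z - y‖ ^ 2 - 1) with huc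
  have hucsmooth : ContDiff ℝ 2 uc := by
    refine contDiff_const.mul (hUsmooth.comp ?_)
    exact (contDiff_const.mul ((contDiff_id.sub contDiff_const).norm_sq ℝ)).sub contDiff_const
  have hmem : ∀ x ∈ annulus y r (2 * r), r < ‖x - y‖ ∧ ‖x - y‖ < 2 * r := fun x hx => by
    have h2 := hx.2
    rw [mem_closedBall, not_le] at h2
    exact ⟨by rwa [← dist_eq_norm], by rw [← dist_eq_norm]; exact hx.1⟩
  have hτ : ∀ x ∈ annulus y r (2 * r), 0 ≤ (r ^ 2)⁻¹ * ‖x - y‖ ^ 2 - 1 ∧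
      (r ^ 2)⁻¹ * ‖x - y‖ ^ 2 - 1 ≤ 3 := fun x hx => by
    obtain ⟨h1, h2⟩ := hmem x hx
    rw [inv_mul_eq_div]
    constructor
    · rw [sub_nonneg, one_le_div (by positivity)]
      gcongr
    · rw [sub_le_iff_le_add, div_le_iff₀ (by positivity)]
      nlinarith
  have hgrad : ∀ x, gradient uc x =
      (-(K ((r ^ 2)⁻¹ * ‖x - y‖ ^ 2 - 1) / (2 * r))) • (x - y) := fun x => by
    rw [huc, (radial_derivatives hU (hKsmooth.differentiable one_ne_zero) _ _ y x).1]
    congr 1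
    field_simp
    ring
  have hnorm : ∀ x, ‖gradient uc x‖ =
      K ((r ^ 2)⁻¹ * ‖x - y‖ ^ 2 - 1) / (2 * r) * ‖x - y‖ := fun x => by
    rw [hgrad, norm_smul, norm_neg, Real.norm_of_nonneg (by
      have := hKpos ((r ^ 2)⁻¹ * ‖x - y‖ ^ 2 - 1)
      positivity)]
  have hnormbd : ∀ x ∈ annulus y r (2 * r),
      K ((r ^ 2)⁻¹ * ‖x - y‖ ^ 2 - 1) / 2 ≤ ‖gradient uc x‖ ∧
        ‖gradient uc x‖ ≤ K ((r ^ 2)⁻¹ * ‖x - y‖ ^ 2 - 1) := fun x hx => by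
    obtain ⟨h1, h2⟩ := hmem x hx
    have hk := hKpos ((r ^ 2)⁻¹ * ‖x - y‖ ^ 2 - 1)
    rw [hnorm, div_mul_eq_mul_div]
    constructor
    · rw [le_div_iff₀ (by positivity)]
      nlinarith
    · rw [div_le_iff₀ (by positivity)]
      nlinarith
  have hhess : ∀ x ∈ annulus y r (2 * r), (hess uc x).IsHermitian ∧
      φ ‖gradient uc x‖ - lam * (hess uc x).trace +
        n * ((Lam - lam) * (K ((r ^ 2)⁻¹ * ‖x - y‖ ^ 2 - 1) / (2 * r))) < 0 ∧
      ∀ v : Fin n → ℝ, -(K ((r ^ 2)⁻¹ * ‖x - y‖ ^ 2 - 1) / (2 * r)) * (v ⬝ᵥ v) ≤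
        v ⬝ᵥ (hess uc x).mulVec v := fun x hx => by
    obtain ⟨h1, h2⟩ := hmem x hx
    have hH : hess uc x =
        (-(K ((r ^ 2)⁻¹ * ‖x - y‖ ^ 2 - 1) / (2 * r))) • (1 : Mat n) +
          (C * φ (K ((r ^ 2)⁻¹ * ‖x - y‖ ^ 2 - 1)) / r ^ 3) •
            Matrix.vecMulVec (x - y).ofLp (x - y).ofLp := by
      rw [huc, (radial_derivatives hU (hKsmooth.differentiable one_ne_zero) _ _ y x).2,
        hKode _ (hτ x hx).1]
      congr 2
      · field_simp
        ring
      · field_simp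
    have hnb := (hnormbd x hx).2
    set k := K ((r ^ 2)⁻¹ * ‖x - y‖ ^ 2 - 1) with hk
    have hkpos : 0 < k := hKpos _
    have hkφ : k ≤ φ k := hφ.2.2 k hkpos.le
    have hφpos : 0 < φ k := hkpos.trans_le hkφ
    have hφle : φ ‖gradient uc x‖ ≤ φ k :=
      hφ.2.1.monotoneOn (norm_nonneg _) hkpos.le hnb
    have hdot : (x - y).ofLp ⬝ᵥ (x - y).ofLp = ‖x - y‖ ^ 2 := by
      rw [EuclideanSpace.real_norm_sq_eq]
      simp only [dotProduct, pow_two]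
    refine ⟨?_, ?_, fun v => ?_⟩
    · rw [hH]
      ext i j
      simp [Matrix.vecMulVec_apply, Matrix.one_apply, eq_comm, mul_comm]
    · rw [hH]
      simp only [Matrix.trace_add, Matrix.trace_smul, Matrix.trace_one, Matrix.trace_vecMulVec,
        hdot, smul_eq_mul, Fintype.card_fin]
      have hbig : C * φ k / r ≤ C * φ k / r ^ 3 * ‖x - y‖ ^ 2 := by
        have : C * φ k / r = C * φ k / r ^ 3 * r ^ 2 := by field_simp
        rw [this]
        gcongr
      have hstrict : φ k + Lam * n * (k / (2 * r)) < lam * (C * φ k / r) := by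
        have : lam * (C * φ k / r) = (rstar + Lam * n + 1) * φ k / r := by
          rw [← hlamC]
          ring
        rw [this, lt_div_iff₀ hr]
        have hsimp : (φ k + Lam * n * (k / (2 * r))) * r = φ k * r + Lam * n * (k / 2) := by
          field_simp
        rw [hsimp]
        have h3 : φ k * r ≤ φ k * rstar := by gcongr
        have h4 : Lam * n * (k / 2) ≤ Lam * n * φ k := by
          gcongr
          linarith
        linarith
      have := mul_le_mul_of_nonneg_left hbig hlam.le
      linarith
    · rw [hH, Matrix.add_mulVec, dotProduct_add, Matrix.smul_mulVec, Matrix.smul_mulVec,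
        Matrix.one_mulVec, dotProduct_smul, dotProduct_smul, Matrix.vecMulVec_mulVec,
        smul_eq_mul, smul_eq_mul]
      refine le_add_of_nonneg_right (mul_nonneg (by positivity) ?_)
      simp only [op_smul_eq_smul, dotProduct_smul, smul_eq_mul]
      rw [dotProduct_comm]
      exact mul_self_nonneg _
  have hucneg : ∀ x ∈ annulus y r (2 * r), uc x ≤ 0 := fun x hx =>
    mul_nonpos_of_nonpos_of_nonneg (by linarith) (hUnonneg _ (hτ x hx).1)
  have hle0 : ∀ X : Mat n, matLE X X := fun X => by
    simpa [matLE] using Matrix.PosSemidef.zero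
  refine ⟨uc, hucsmooth.contDiffOn, hucsmooth.continuous.continuousOn, fun x hx => ?_,
    fun x hx => ?_, fun x hx => ?_, fun F hF1 hF2 => ⟨hucsmooth.contDiffOn, fun x hx => ?_⟩,
    fun F hF1 hF2 => ⟨hucsmooth.neg.contDiffOn, fun x hx => ?_⟩⟩
  · rw [mem_sphere, dist_eq_norm] at hx
    have : (r ^ 2)⁻¹ * r ^ 2 - 1 = 0 := by field_simp; ring
    simp [huc, hx, this, hUdef]
  · rw [mem_sphere, dist_eq_norm] at hx
    have : (r ^ 2)⁻¹ * (2 * r) ^ 2 - 1 = 3 := by field_simp; ring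
    simp only [huc, hx, this]
    ring
  · obtain ⟨h1, h2⟩ := hnormbd x hx
    have h3 := hKanti (hτ x hx).2
    have h4 := hK1 _ (hτ x hx).1
    refine ⟨by linarith, (h2.trans h4).trans ?_⟩
    rw [one_le_inv₀ (by linarith [hKpos 3])]
    linarith
  · obtain ⟨hsymm, hneg, hlow⟩ := hhess x hx
    have hb := hKpos ((r ^ 2)⁻¹ * ‖x - y‖ ^ 2 - 1)
    have h1 := hF1 x 0 (uc x) (gradient uc x) _ _ (hucneg x hx) (hle0 (hess uc x))
    have h2 := hF2 x (gradient uc x) _ hsymm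
    have h3 := pucciPlus_le hlamLam (by positivity) hsymm hlow
    linarith
  · obtain ⟨hsymm, hneg, hlow⟩ := hhess x hx
    have hb := hKpos ((r ^ 2)⁻¹ * ‖x - y‖ ^ 2 - 1)
    rw [gradient_neg_fun, hess_neg_fun]
    have h1 := hF1 x (-uc x) 0 (-gradient uc x) _ _ (neg_nonneg.2 (hucneg x hx))
      (hle0 (-hess uc x))
    have h2 := hF2 x (-gradient uc x) _ hsymm.neg
    have h3 := le_pucciMinus_neg hlamLam (by positivity) hsymm hlow
    rw [norm_neg] at h2
    linarith
end
end

section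
/- Assume 0 < λ ≤ Λ, that φ satisfies the Osgood condition (φ_A), and let γ, C* be as in (F2B*). Let 0 < r* ≤ 1 and M > 0. Then there exist constants m and μ with 0 < m ≤ M, where m depends only on λ, Λ, n, φ, r*, C* and μ depends in addition on M, such that for every y ∈ ℝⁿ and every 0 < r ≤ r* there is a C² function u on the annulus A = B(y,2r) ∖ closure(B(y,r)), continuous up to the closure of A, satisfying u = m·r on ∂B(y,r), u = 0 on ∂B(y,2r), μ ≤ |Du(x)| ≤ μ⁻¹ for all x ∈ A, and u is a strict classical subsolution in A of F(x,u,Du,D²u) = 0 for every F satisfying (F1) and (F2B*) with these λ, Λ, φ, γ, C*. -/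
open Metric Set Filter MeasureTheory
open scoped Topology RealInnerProductSpace Classical

noncomputable section

variable {n : ℕ}

/-- Pucci bound for a symmetric matrix whose eigenvalues are bounded below by `-a`. -/
theorem pucciPlus_le_of_posSemidef {lam Lam a : ℝ} (hlamLam : lam ≤ Lam) (ha : 0 ≤ a)
    {X : Mat n} (hX : X.IsHermitian) (hXa : (X + a • (1 : Mat n)).PosSemidef) :
    pucciPlus lam Lam X ≤ (Lam - lam) * (n * a) - lam * X.trace := by
  have hev : ∀ i, -a ≤ hX.eigenvalues i := by
    intro i
    have h1 := hXa.dotProduct_mulVec_nonneg (hX.eigenvectorBasis i)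
    have h2 := hX.mulVec_eigenvectorBasis i
    have h3 : (star (hX.eigenvectorBasis i : Fin n → ℝ)) ⬝ᵥ (hX.eigenvectorBasis i : Fin n → ℝ)
        = 1 := by
      have h4 := hX.eigenvectorBasis.orthonormal.1 i
      have h5 := real_inner_self_eq_norm_sq (hX.eigenvectorBasis i)
      rw [h4, EuclideanSpace.inner_eq_star_dotProduct, dotProduct_comm] at h5
      simpa using h5
    rw [Matrix.add_mulVec, h2, Matrix.smul_mulVec, Matrix.one_mulVec, dotProduct_add,
      dotProduct_smul, dotProduct_smul, h3] at h1
    simp only [smul_eq_mul, mul_one] at h1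
    linarith
  have htr : X.trace = ∑ i, hX.eigenvalues i := by
    simpa using hX.trace_eq_sum_eigenvalues
  have hsum : (Lam - lam) * (n * a) - lam * X.trace
      = ∑ i : Fin n, ((Lam - lam) * a - lam * hX.eigenvalues i) := by
    rw [htr, Finset.sum_sub_distrib, Finset.mul_sum]
    simp
    ring
  rw [hsum, pucciPlus]
  refine Finset.sum_le_sum fun i _ => ?_
  simp only [eigenvals, dif_pos hX]
  split_ifs with h
  · nlinarith [mul_nonneg (sub_nonneg.2 hlamLam) ha]
  · nlinarith [mul_le_mul_of_nonneg_left (hev i) (sub_nonneg.2 hlamLam)]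

/-- An increasing diffeomorphism of the line with prescribed positive continuous derivative. -/
theorem exists_inverse_of_primitive {q : ℝ → ℝ} (hq : Continuous q) (hq0 : ∀ x, 0 < q x)
    (htop : Tendsto (fun x => ∫ t in (0:ℝ)..x, q t) atTop atTop)
    (hbot : Tendsto (fun x => ∫ t in (0:ℝ)..x, q t) atBot atBot) :
    ∃ k : ℝ → ℝ, StrictMono k ∧ k 0 = 0 ∧ (∀ x, k (∫ t in (0:ℝ)..x, q t) = x) ∧
      ∀ s, HasDerivAt k (q (k s))⁻¹ s := by
  set h : ℝ → ℝ := fun x => ∫ t in (0:ℝ)..x, q t with hh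
  have hd : ∀ x, HasDerivAt h (q x) x := fun x => hq.integral_hasStrictDerivAt 0 x |>.hasDerivAt
  have hmono : StrictMono h := strictMono_of_deriv_pos fun x => by rw [(hd x).deriv]; exact hq0 x
  have hcont : Continuous h := continuous_iff_continuousAt.2 fun x => (hd x).continuousAt
  have hsurj : Function.Surjective h := hcont.surjective htop hbot
  let e : ℝ ≃o ℝ := hmono.orderIsoOfSurjective h hsurj
  have he : ∀ x, e x = h x := fun x => rfl
  refine ⟨e.symm, e.symm.strictMono, ?_, fun x => ?_, fun s => ?_⟩
  · rw [e.symm_apply_eq, he, hh]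
    simp
  · exact e.symm_apply_apply x
  · exact (hd _).of_local_left_inverse e.symm.continuous.continuousAt (hq0 _).ne'
      (Eventually.of_forall fun y => e.apply_symm_apply y)

theorem PhiAdmissible.pos {φ : ℝ → ℝ} (hφ : PhiAdmissible φ) {t : ℝ} (ht : 0 < t) : 0 < φ t :=
  ht.trans_le (hφ.2.2 t ht.le)

/-- Under the Osgood condition, `g' = -K φ(g)` has positive solutions, as small as desired,
on the whole half-line; they extend to `C¹` functions on `ℝ`. -/
theorem exists_osgood_profile {φ : ℝ → ℝ} (hφ : PhiAdmissible φ) (hOsg : OsgoodCondition φ)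
    {K ε : ℝ} (hK : 0 < K) (hε : 0 < ε) (hε1 : ε ≤ 1) :
    ∃ g : ℝ → ℝ, ContDiff ℝ 1 g ∧ Antitone g ∧ (∀ s, 0 < g s) ∧ g 0 = ε ∧
      ∀ s, 0 ≤ s → HasDerivAt g (-(K * φ (g s))) s := by
  set q : ℝ → ℝ := fun x => Real.exp (min x 0) / φ (Real.exp (min x 0)) with hqdef
  have hφexp : Continuous fun x => φ (Real.exp x) := by
    refine hφ.1.comp_continuous Real.continuous_exp fun x => (Real.exp_pos x).le
  have hφmin : Continuous fun x => φ (Real.exp (min x 0)) :=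
    hφexp.comp (continuous_id.min continuous_const)
  have hq : Continuous q :=
    (Real.continuous_exp.comp (continuous_id.min continuous_const)).div hφmin
      fun x => (hφ.pos (Real.exp_pos _)).ne'
  have hq0 : ∀ x, 0 < q x := fun x => div_pos (Real.exp_pos _) (hφ.pos (Real.exp_pos _))
  have htop : Tendsto (fun x => ∫ t in (0:ℝ)..x, q t) atTop atTop := by
    have h1 : Tendsto (fun x : ℝ => x * q 0) atTop atTop :=
      tendsto_id.atTop_mul_const (hq0 0)
    refine h1.congr' ?_
    filter_upwards [eventually_ge_atTop (0:ℝ)] with x hx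
    have h2 : ∫ t in (0:ℝ)..x, q t = ∫ t in (0:ℝ)..x, q 0 := by
      refine intervalIntegral.integral_congr fun t ht => ?_
      rw [uIcc_of_le hx] at ht
      simp [hqdef, min_eq_right ht.1]
    rw [h2]
    simp
  have hbot : Tendsto (fun x => ∫ t in (0:ℝ)..x, q t) atBot atBot := by
    have h1 : Tendsto Real.exp atBot (𝓝[>] 0) := Real.tendsto_exp_atBot_nhdsGT
    refine (tendsto_neg_atTop_atBot.comp (hOsg.comp h1)).congr' ?_
    filter_upwards [eventually_le_atBot (0:ℝ)] with x hx
    have h2 : ∫ t in x..(0:ℝ), q t = ∫ t in x..(0:ℝ), (1 / φ (Real.exp t)) * Real.exp t := by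
      refine intervalIntegral.integral_congr fun t ht => ?_
      rw [uIcc_of_le hx] at ht
      simp only [hqdef, min_eq_left ht.2]
      ring
    have h3 : ∫ t in x..(0:ℝ), ((fun t => 1 / φ t) ∘ Real.exp) t * Real.exp t
        = ∫ t in Real.exp x..Real.exp 0, 1 / φ t := by
      refine intervalIntegral.integral_comp_mul_deriv' (fun t _ => Real.hasDerivAt_exp t)
        Real.continuous_exp.continuousOn ?_
      refine continuousOn_const.div (hφ.1.mono ?_) ?_
      · rintro _ ⟨t, _, rfl⟩
        exact (Real.exp_pos t).le
      · rintro _ ⟨t, _, rfl⟩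
        exact (hφ.pos (Real.exp_pos t)).ne'
    rw [intervalIntegral.integral_symm, h2]
    simp only [Function.comp_apply, Real.exp_zero] at h3 ⊢
    rw [h3]
  obtain ⟨k, hkm, hk0, hkh, hkd⟩ := exists_inverse_of_primitive hq hq0 htop hbot
  set c : ℝ := ∫ t in (0:ℝ)..Real.log ε, q t with hc
  have hkc : k c = Real.log ε := hkh _
  have hc0 : c ≤ 0 := by
    rw [← hkm.le_iff_le, hkc, hk0]
    exact Real.log_nonpos hε.le hε1
  have hkcont : Continuous k := continuous_iff_continuousAt.2 fun x => (hkd x).continuousAt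
  have hgd : ∀ s, HasDerivAt (fun s => Real.exp (k (c - K * s)))
      (Real.exp (k (c - K * s)) * ((q (k (c - K * s)))⁻¹ * -K)) s := by
    intro s
    have h1 : HasDerivAt (fun s => c - K * s) (-K) s := by
      simpa using ((hasDerivAt_id s).const_mul K).const_sub c
    exact ((hkd _).comp s h1).exp
  refine ⟨fun s => Real.exp (k (c - K * s)), ?_, ?_, fun s => Real.exp_pos _, ?_, ?_⟩
  · rw [contDiff_one_iff_deriv]
    refine ⟨fun s => (hgd s).differentiableAt, ?_⟩
    rw [funext fun s => (hgd s).deriv]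
    have h1 : Continuous fun s => k (c - K * s) := by fun_prop
    exact (Real.continuous_exp.comp h1).mul
      (((hq.comp h1).inv₀ fun s => (hq0 _).ne').mul continuous_const)
  · intro s t hst
    refine Real.exp_le_exp.2 (hkm.monotone ?_)
    nlinarith
  · simp [hkc, Real.exp_log hε]
  · intro s hs
    convert hgd s using 1
    have h1 : k (c - K * s) ≤ 0 := by
      rw [← hk0]
      exact hkm.monotone (by nlinarith [mul_nonneg hK.le hs])
    simp only [hqdef, min_eq_left h1]
    have h2 := (hφ.pos (Real.exp_pos (k (c - K * s)))).ne'
    have h3 := (Real.exp_pos (k (c - K * s))).ne'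
    field_simp

theorem hasFDerivAt_radial {V : ℝ → ℝ} {V' : ℝ} {y x : Eucl n}
    (hV : HasDerivAt V V' (‖x - y‖ ^ 2)) :
    HasFDerivAt (fun z => V (‖z - y‖ ^ 2)) ((2 * V') • innerSL ℝ (x - y)) x := by
  have h1 : HasFDerivAt (fun z : Eucl n => ‖z - y‖ ^ 2)
      (2 • (innerSL ℝ (x - y)).comp (ContinuousLinearMap.id ℝ (Eucl n))) x :=
    ((hasFDerivAt_id x).sub_const y).norm_sq
  refine (hV.comp_hasFDerivAt x h1).congr_fderiv ?_
  ext v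
  simp
  ring

theorem gradient_radial {V : ℝ → ℝ} {V' : ℝ} {y x : Eucl n}
    (hV : HasDerivAt V V' (‖x - y‖ ^ 2)) :
    gradient (fun z => V (‖z - y‖ ^ 2)) x = (2 * V') • (x - y) := by
  refine HasGradientAt.gradient ?_
  rw [hasGradientAt_iff_hasFDerivAt]
  refine (hasFDerivAt_radial hV).congr_fderiv ?_
  ext v
  simp

theorem hess_radial {V V' : ℝ → ℝ} {V'' : ℝ} {y x : Eucl n}
    (hV : ∀ᶠ t in 𝓝 (‖x - y‖ ^ 2), HasDerivAt V (V' t) t)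
    (hV' : HasDerivAt V' V'' (‖x - y‖ ^ 2)) :
    hess (fun z => V (‖z - y‖ ^ 2)) x =
      (2 * V' (‖x - y‖ ^ 2)) • (1 : Mat n) +
        (4 * V'') • Matrix.vecMulVec (x - y : Eucl n) (x - y : Eucl n) := by
  have hcont : ContinuousAt (fun z : Eucl n => ‖z - y‖ ^ 2) x := by fun_prop
  have h1 : fderiv ℝ (fun z => V (‖z - y‖ ^ 2)) =ᶠ[𝓝 x]
      fun z => (2 * V' (‖z - y‖ ^ 2)) • innerSL ℝ (z - y) := by
    filter_upwards [hcont.eventually hV] with z hz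
    exact (hasFDerivAt_radial hz).fderiv
  let B : Eucl n →L[ℝ] Eucl n →L[ℝ] ℝ := innerSL ℝ
  have hB : ∀ a b, B a b = inner ℝ a b := fun _ _ => rfl
  have h2 : HasFDerivAt (fun z : Eucl n => innerSL ℝ (z - y)) B x :=
    B.hasFDerivAt.comp x ((hasFDerivAt_id x).sub_const y)
  have h3 : HasFDerivAt (fun z => (2 * V' (‖z - y‖ ^ 2)) • innerSL ℝ (z - y)) _ x :=
    ((hasFDerivAt_radial hV').const_mul 2).smul h2
  ext i j
  rw [hess, Matrix.of_apply, iteratedFDeriv_two_apply, h1.fderiv_eq, h3.fderiv]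
  simp [hB, Matrix.vecMulVec_apply, Matrix.one_apply, EuclideanSpace.inner_single_right, eq_comm]
  ring

theorem hasDerivAt_radial_profile {W g : ℝ → ℝ} (hW : ∀ s, HasDerivAt W (-g s) s) {r t : ℝ}
    (hr : 0 < r) (ht : 0 < t) :
    HasDerivAt (fun t => r * W (√t / r)) (-(g (√t / r) / (2 * √t))) t := by
  have h1 : HasDerivAt (fun t => √t / r) (1 / (2 * √t) / r) t :=
    (Real.hasDerivAt_sqrt ht.ne').div_const r
  refine (((hW _).comp t h1).const_mul r).congr_deriv ?_
  have := Real.sqrt_pos.2 ht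
  field_simp

theorem hasDerivAt_radial_profile_deriv {g : ℝ → ℝ} {D r ρ : ℝ} (hr : 0 < r) (hρ : 0 < ρ)
    (hg : HasDerivAt g (-D) (ρ / r)) :
    HasDerivAt (fun t => -(g (√t / r) / (2 * √t)))
      ((D / r + g (ρ / r) / ρ) / (4 * ρ ^ 2)) (ρ ^ 2) := by
  have hs : √(ρ ^ 2) = ρ := Real.sqrt_sq hρ.le
  have h0 : HasDerivAt (fun t => √t) (1 / (2 * ρ)) (ρ ^ 2) := by
    simpa only [hs] using Real.hasDerivAt_sqrt (pow_pos hρ 2).ne'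
  have hg' : HasDerivAt g (-D) (√(ρ ^ 2) / r) := by rwa [hs]
  have h1 : HasDerivAt (fun t => g (√t / r)) (-D * (1 / (2 * ρ) / r)) (ρ ^ 2) :=
    hg'.comp (ρ ^ 2) (h0.div_const r)
  refine (h1.div (h0.const_mul 2) (by rw [hs]; positivity)).neg.congr_deriv ?_
  simp only [hs]
  field_simp
  ring

/-- Pucci bound for the Hessian of a decreasing radial function. -/
theorem pucciPlus_radial_le {lam Lam a b : ℝ} (hlamLam : lam ≤ Lam) (ha : 0 ≤ a) (hb : 0 ≤ b)
    (z : Eucl n) :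
    (-a • (1 : Mat n) + b • Matrix.vecMulVec z z).IsHermitian ∧
      pucciPlus lam Lam (-a • (1 : Mat n) + b • Matrix.vecMulVec z z)
        ≤ Lam * n * a - lam * (b * ‖z‖ ^ 2) := by
  have hP : (b • Matrix.vecMulVec (z : Fin n → ℝ) z).PosSemidef := by
    simpa using (Matrix.posSemidef_vecMulVec_self_star (z : Fin n → ℝ)).smul hb
  have hH : (-a • (1 : Mat n) + b • Matrix.vecMulVec z z).IsHermitian :=
    (show ((-a) • (1 : Mat n)).IsHermitian by
      simp [Matrix.IsHermitian]).add hP.1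
  refine ⟨hH, ?_⟩
  have h1 := pucciPlus_le_of_posSemidef hlamLam ha hH (lam := lam) (by
    convert hP using 1
    module)
  have htr : (-a • (1 : Mat n) + b • Matrix.vecMulVec z z).trace = -a * n + b * ‖z‖ ^ 2 := by
    rw [Matrix.trace_add, Matrix.trace_smul, Matrix.trace_smul, Matrix.trace_one,
      Matrix.trace_vecMulVec, EuclideanSpace.real_norm_sq_eq]
    simp [dotProduct, sq]
  rw [htr] at h1
  linarith

/-- Lemma 3.2: positive strict classical subsolution barrier in an annulus,
under the structure condition (F2B*). -/
theorem barrier_positive_subsolution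
    {n : ℕ} (lam Lam : ℝ) (hlam : 0 < lam) (hlamLam : lam ≤ Lam)
    (φ γF : ℝ → ℝ) (hφ : PhiAdmissible φ) (hOsg : OsgoodCondition φ)
    (Cstar : ℝ) (hCstar : 0 < Cstar) (hγ : GammaDominated Cstar φ γF)
    (rstar M : ℝ) (hrstar : 0 < rstar) (hrstar1 : rstar ≤ 1) (hM : 0 < M) :
    ∃ m μ : ℝ, 0 < m ∧ m ≤ M ∧ 0 < μ ∧
      ∀ (y : Eucl n) (r : ℝ), 0 < r → r ≤ rstar →
        ∃ uc : Eucl n → ℝ,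
          ContDiffOn ℝ 2 uc (annulus y r (2*r)) ∧
          ContinuousOn uc (closure (annulus y r (2*r))) ∧
          (∀ x ∈ sphere y r, uc x = m*r) ∧
          (∀ x ∈ sphere y (2*r), uc x = 0) ∧
          (∀ x ∈ annulus y r (2*r), μ ≤ ‖gradient uc x‖ ∧ ‖gradient uc x‖ ≤ μ⁻¹) ∧
          (∀ F : Eucl n → ℝ → Eucl n → Mat n → ℝ, CondF1 F → CondF2Bstar lam Lam φ γF F →
            StrictClassicalSubsolution F (annulus y r (2*r)) uc) := by
  obtain ⟨ε, hε, hε1, hεM⟩ : ∃ ε : ℝ, 0 < ε ∧ ε ≤ 1 ∧ ε ≤ M :=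
    ⟨min 1 M, lt_min one_pos hM, min_le_left _ _, min_le_right _ _⟩
  have hLam : 0 < Lam := hlam.trans_le hlamLam
  set K : ℝ := (2 + Cstar + Lam * n) / lam with hKdef
  have hK : 0 < K := by positivity
  have hKlam : lam * K = 2 + Cstar + Lam * n := by rw [hKdef]; field_simp
  obtain ⟨g, hgC, hganti, hgpos, hg0, hgd⟩ := exists_osgood_profile hφ hOsg hK hε hε1
  set W : ℝ → ℝ := fun s => ∫ t in s..2, g t with hWdef
  have hW : ∀ s, HasDerivAt W (-g s) s := fun s =>
    intervalIntegral.integral_hasDerivAt_left (hgC.continuous.intervalIntegrable _ _)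
      hgC.continuous.stronglyMeasurable.stronglyMeasurableAtFilter hgC.continuous.continuousAt
  have hWC : ContDiff ℝ 2 W := by
    rw [show (2 : WithTop ℕ∞) = 1 + 1 by norm_num, contDiff_succ_iff_deriv]
    refine ⟨fun s => (hW s).differentiableAt, by simp, ?_⟩
    rw [funext fun s => (hW s).deriv]
    exact hgC.neg
  have hWpos : ∀ s, s < 2 → 0 < W s := fun s hs =>
    intervalIntegral.intervalIntegral_pos_of_pos (hgC.continuous.intervalIntegrable _ _) hgpos hs
  have hWle : ∀ s, 1 ≤ s → s ≤ 2 → W s ≤ g s := by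
    intro s hs1 hs2
    have h1 : W s ≤ ∫ t in s..2, g s :=
      intervalIntegral.integral_mono_on hs2 (hgC.continuous.intervalIntegrable _ _)
        intervalIntegrable_const fun t ht => hganti ht.1
    rw [intervalIntegral.integral_const, smul_eq_mul] at h1
    nlinarith [hgpos s]
  have hgε : ∀ s, 0 ≤ s → g s ≤ ε := fun s hs => hg0 ▸ hganti hs
  have hμpos : 0 < min (g 2) (g 1)⁻¹ := lt_min (hgpos 2) (inv_pos.2 (hgpos 1))
  refine ⟨W 1, min (g 2) (g 1)⁻¹, hWpos 1 (by norm_num),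
    ((hWle 1 le_rfl (by norm_num)).trans (hgε 1 zero_le_one)).trans hεM, hμpos, ?_⟩
  intro y r hr hrr
  have hr1 : r ≤ 1 := hrr.trans hrstar1
  have hann : ∀ x ∈ annulus y r (2 * r), r < ‖x - y‖ ∧ ‖x - y‖ < 2 * r := by
    intro x hx
    simpa [annulus, dist_eq_norm, and_comm] using hx
  set V : ℝ → ℝ := fun t => r * W (√t / r) with hVdef
  have hVsq : ∀ x : Eucl n, V (‖x - y‖ ^ 2) = r * W (‖x - y‖ / r) := fun x => by
    simp only [hVdef, Real.sqrt_sq (norm_nonneg _)]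
  have hVd : ∀ t, 0 < t → HasDerivAt V (-(g (√t / r) / (2 * √t))) t :=
    fun t ht => hasDerivAt_radial_profile hW hr ht
  have hC : ContDiffOn ℝ 2 (fun x : Eucl n => V (‖x - y‖ ^ 2)) (annulus y r (2 * r)) := by
    simp only [hVsq]
    intro x hx
    have hne : x - y ≠ 0 := norm_pos_iff.1 (hr.trans (hann x hx).1)
    have h1 : ContDiffAt ℝ 2 (fun x : Eucl n => ‖x - y‖ / r) x :=
      ((contDiffAt_id.sub contDiffAt_const).norm ℝ hne).div_const r
    exact (contDiffAt_const.mul (hWC.contDiffAt.comp x h1)).contDiffWithinAt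
  have hgrad : ∀ x ∈ annulus y r (2 * r),
      ‖gradient (fun x : Eucl n => V (‖x - y‖ ^ 2)) x‖ = g (‖x - y‖ / r) := by
    intro x hx
    have hρ : 0 < ‖x - y‖ := hr.trans (hann x hx).1
    rw [gradient_radial (hVd _ (pow_pos hρ 2)), norm_smul, Real.sqrt_sq hρ.le, Real.norm_eq_abs,
      mul_neg, abs_neg, abs_of_nonneg (by have := hgpos (‖x - y‖ / r); positivity)]
    field_simp
  have hs : ∀ x ∈ annulus y r (2 * r), 1 < ‖x - y‖ / r ∧ ‖x - y‖ / r < 2 := fun x hx =>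
    ⟨(one_lt_div hr).2 (hann x hx).1, (div_lt_iff₀ hr).2 (hann x hx).2⟩
  refine ⟨fun x => V (‖x - y‖ ^ 2), hC, ?_, ?_, ?_, ?_, fun F _ hF => ⟨hC, fun x hx => ?_⟩⟩
  · simp only [hVsq]
    have := hWC.continuous
    exact Continuous.continuousOn (by fun_prop)
  · intro x hx
    rw [mem_sphere_iff_norm] at hx
    simp only [hVsq]
    rw [hx, div_self hr.ne', mul_comm]
  · intro x hx
    rw [mem_sphere_iff_norm] at hx
    simp only [hVsq]
    simp [hx, hr.ne', hWdef]
  · intro x hx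
    rw [hgrad x hx]
    refine ⟨(min_le_left _ _).trans (hganti (hs x hx).2.le), (hganti (hs x hx).1.le).trans ?_⟩
    rw [le_inv_comm₀ (hgpos 1) hμpos]
    exact min_le_right _ _
  · obtain ⟨hx1, hx2⟩ := hs x hx
    have hrρ : r < ‖x - y‖ := (hann x hx).1
    have hgr := hgrad x hx
    set ρ := ‖x - y‖ with hρdef
    have hρ : 0 < ρ := hr.trans hrρ
    set G := g (ρ / r) with hG
    have hGpos : 0 < G := hgpos _
    have hφG : G ≤ φ G := hφ.2.2 G hGpos.le
    have hφG0 : 0 < φ G := hφ.pos hGpos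
    have hgds : HasDerivAt g (-(K * φ G)) (ρ / r) := hgd _ (zero_le_one.trans hx1.le)
    have hH := hess_radial (y := y) (x := x)
      ((eventually_gt_nhds (pow_pos hρ 2)).mono fun t ht => hVd t ht)
      (hasDerivAt_radial_profile_deriv hr hρ hgds)
    have hP := pucciPlus_radial_le hlamLam (a := G / ρ)
      (b := 4 * ((K * φ G / r + G / ρ) / (4 * ρ ^ 2))) (lam := lam) (by positivity) (by positivity)
      (x - y)
    have hcoef : 2 * -(g (√(‖x - y‖ ^ 2) / r) / (2 * √(‖x - y‖ ^ 2))) = -(G / ρ) := by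
      rw [← hρdef, Real.sqrt_sq hρ.le, ← hG]
      field_simp
    rw [hcoef] at hH
    rw [← hH] at hP
    have hb : 4 * ((K * φ G / r + G / ρ) / (4 * ρ ^ 2)) * ‖x - y‖ ^ 2 = K * φ G / r + G / ρ := by
      rw [← hρdef]
      field_simp
    rw [hb] at hP
    have hu : V (ρ ^ 2) = r * W (ρ / r) := hVsq x
    have hWp := hWpos _ hx2
    have hupos : 0 < V (ρ ^ 2) := by rw [hu]; positivity
    have huG : V (ρ ^ 2) ≤ G := by
      rw [hu]
      nlinarith [hWle _ hx1.le hx2.le]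
    have hγu : γF (V (ρ ^ 2)) ≤ Cstar * φ G :=
      (hγ.2 _ hupos (huG.trans ((hgε _ (by positivity)).trans hε1))).trans
        (mul_le_mul_of_nonneg_left (hφ.2.1.monotoneOn hupos.le hGpos.le huG) hCstar.le)
    have hFx := hF x (V (ρ ^ 2)) (gradient (fun x : Eucl n => V (‖x - y‖ ^ 2)) x) _ hupos hP.1
    rw [hgr] at hFx
    have h1 : φ G ≤ φ G / r := le_div_self hφG0.le hr hr1
    have h2 : G / ρ ≤ φ G / r := div_le_div₀ hφG0.le hφG hr hrρ.le
    have h3 : lam * (K * φ G / r + G / ρ) = (2 + Cstar + Lam * n) * (φ G / r) + lam * (G / ρ) := by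
      rw [← hKlam]
      ring
    have h4 : Lam * n * (G / ρ) ≤ Lam * n * (φ G / r) :=
      mul_le_mul_of_nonneg_left h2 (by positivity)
    have h5 : Cstar * φ G ≤ Cstar * (φ G / r) := mul_le_mul_of_nonneg_left h1 hCstar.le
    have h6 : 0 < lam * (G / ρ) := by positivity
    have h7 := hP.2
    rw [h3] at h7
    have h8 : 0 < φ G / r := by positivity
    refine hFx.trans_lt ?_
    linarith
end
end

section
/- Necessity of the Osgood condition: let φ : [0,∞) → [0,∞) be continuous and strictly increasing with φ(0) = 0 and φ(t) ≥ t for all t, and suppose the Osgood condition fails, i.e. ∫₀¹ dt/φ(t) < ∞. Then there exist δ ∈ (0,1] and a nonconstant C¹ function H : (−1,δ) → ℝ which is twice differentiable at every point and satisfies H″(x) + φ(|H′(x)|) = 0 for all x ∈ (−1,δ), with H ≡ 1 on (−1,0] and H strictly decreasing on [0,δ). In particular, a classical solution of u″ + φ(|u′|) = 0 can attain a positive interior maximum without being constant, so the strong maximum principle and the Hopf lemma fail without the Osgood condition. -/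
open Metric Set Filter MeasureTheory
open scoped Topology RealInnerProductSpace Classical

noncomputable section

variable {n : ℕ}

/-- A continuous positive speed whose reciprocal is integrable near the equilibrium `0` admits a
solution of `h' = Φ(h)` that leaves `0` at time `0`. Here `ψ` is the reciprocal of `Φ` on the
positive half-line. -/
lemma exists_hasDerivAt_leaving_zero (Φ ψ : ℝ → ℝ) (hΦ : Continuous Φ) (hΦ0 : Φ 0 = 0)
    (hψ : ∀ t, 0 < t → ψ t = (Φ t)⁻¹) (hΦpos : ∀ t, 0 < t → 0 < Φ t)
    (c : ℝ) (hc : 0 < c) (hcψ : ∀ t, c ≤ ψ t)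
    (hint : ∀ a b, IntervalIntegrable ψ volume a b) :
    ∃ h : ℝ → ℝ, (∀ x, HasDerivAt h (Φ (h x)) x) ∧ (∀ x, x ≤ 0 → h x = 0) ∧
      (∀ x, 0 < x → 0 < h x) ∧ ∃ T > 0, ∀ x, x ≤ T → h x ≤ 1 := by
  set G : ℝ → ℝ := fun t => ∫ s in (0 : ℝ)..t, ψ s with hG
  have hG0 : G 0 = 0 := by simp [hG]
  have hsub : ∀ a b, G b - G a = ∫ s in a..b, ψ s := fun a b =>
    intervalIntegral.integral_interval_sub_left (hint 0 b) (hint 0 a)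
  have hlow : ∀ a b, a ≤ b → c * (b - a) ≤ G b - G a := by
    intro a b hab
    rw [hsub]
    have := intervalIntegral.integral_mono_on hab (intervalIntegrable_const (c := c)) (hint a b)
      (fun x _ => hcψ x)
    simpa [mul_comm] using this
  have hmono : StrictMono G := fun a b hab => by
    have := hlow a b hab.le
    have := mul_pos hc (sub_pos.2 hab)
    linarith
  have hGc : Continuous G := intervalIntegral.continuous_primitive hint 0
  have htop : Tendsto G atTop atTop := by
    refine tendsto_atTop_mono' _ ?_ (tendsto_id.const_mul_atTop hc)
    filter_upwards [eventually_ge_atTop 0] with t ht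
    have := hlow 0 t ht
    simp only [id]
    linarith
  have hbot : Tendsto G atBot atBot := by
    refine tendsto_atBot_mono' _ ?_ (tendsto_id.const_mul_atBot hc)
    filter_upwards [eventually_le_atBot 0] with t ht
    have := hlow t 0 ht
    simp only [id]
    linarith
  set e := hmono.orderIsoOfSurjective G (hGc.surjective htop hbot) with he
  have heG : ∀ t, e t = G t := fun _ => rfl
  have he0 : e.symm 0 = 0 := by rw [e.symm_apply_eq, heG, hG0]
  have hgc : Continuous e.symm := e.symm.continuous
  have hgpos : ∀ x, 0 < x → 0 < e.symm x := fun x hx => by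
    simpa only [he0] using e.symm.strictMono hx
  have hgd : ∀ x, 0 < x → HasDerivAt e.symm (Φ (e.symm x)) x := by
    intro x hx
    have hp := hgpos x hx
    have hev : ψ =ᶠ[𝓝 (e.symm x)] fun t => (Φ t)⁻¹ := by
      filter_upwards [Ioi_mem_nhds hp] with t ht using hψ t ht
    have hcont : ContinuousOn ψ (Ioi 0) :=
      (hΦ.continuousOn.inv₀ fun t ht => (hΦpos t ht).ne').congr fun t ht => hψ t ht
    have hd : HasDerivAt G (ψ (e.symm x)) (e.symm x) :=
      intervalIntegral.integral_hasDerivAt_right (hint _ _)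
        (hcont.stronglyMeasurableAtFilter isOpen_Ioi _ hp)
        (hcont.continuousAt (Ioi_mem_nhds hp))
    rw [hψ _ hp] at hd
    have := hd.of_local_left_inverse hgc.continuousAt (inv_ne_zero (hΦpos _ hp).ne')
      (Eventually.of_forall fun y => e.apply_symm_apply y)
    simpa using this
  set h : ℝ → ℝ := fun x => max (e.symm x) 0 with hh
  have hhc : Continuous h := hgc.max continuous_const
  have hneg : ∀ x, x ≤ 0 → h x = 0 := fun x hx =>
    max_eq_right (by simpa only [he0] using e.symm.monotone hx)
  have hpos : ∀ x, 0 < x → h x = e.symm x := fun x hx => max_eq_left (hgpos x hx).le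
  have hne : ∀ x, x ≠ 0 → HasDerivAt h (Φ (h x)) x := by
    intro x hx
    rcases lt_or_gt_of_ne hx with hx | hx
    · rw [hneg x hx.le, hΦ0]
      refine (hasDerivAt_const x (0 : ℝ)).congr_of_eventuallyEq ?_
      filter_upwards [Iio_mem_nhds hx] with y hy using hneg y (le_of_lt hy)
    · rw [hpos x hx]
      refine (hgd x hx).congr_of_eventuallyEq ?_
      filter_upwards [Ioi_mem_nhds hx] with y hy using hpos y hy
  refine ⟨h, fun x => ?_, hneg, fun x hx => by rw [hpos x hx]; exact hgpos x hx, G 1, ?_, ?_⟩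
  · by_cases hx : x = 0
    · subst hx
      exact hasDerivAt_of_hasDerivAt_of_ne (fun y hy => hne y hy) hhc.continuousAt
        (hΦ.comp hhc).continuousAt
    · exact hne x hx
  · simpa only [hG0] using hmono zero_lt_one
  · intro x hx
    refine max_le ?_ zero_le_one
    rw [← heG] at hx
    simpa using e.symm.monotone hx

/-- Extending an integrable function on `(0, 1]` by constants gives a function that is
integrable on every bounded interval. -/
lemma intervalIntegrable_of_constant_extension {ψ : ℝ → ℝ} {a b : ℝ}
    (hleft : ∀ t, t ≤ 0 → ψ t = a) (hmid : IntegrableOn ψ (Ioc 0 1))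
    (hright : ∀ t, 1 < t → ψ t = b) (u v : ℝ) : IntervalIntegrable ψ volume u v := by
  have hL : ∀ u, u ≤ 0 → IntervalIntegrable ψ volume u 0 := fun u hu =>
    (intervalIntegrable_const (c := a)).congr fun t ht => by
      rw [uIoc_of_le hu] at ht
      exact (hleft t ht.2).symm
  have h01 : IntervalIntegrable ψ volume 0 1 :=
    (intervalIntegrable_iff_integrableOn_Ioc_of_le zero_le_one).2 hmid
  have hR : ∀ v, 1 ≤ v → IntervalIntegrable ψ volume 1 v := fun v hv =>
    (intervalIntegrable_const (c := b)).congr fun t ht => by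
      rw [uIoc_of_le hv] at ht
      exact (hright t ht.1).symm
  have key : ∀ m, IntervalIntegrable ψ volume 0 m := by
    intro m
    rcases le_total m 0 with hm | hm
    · exact (hL m hm).symm
    · exact (h01.trans (hR _ (le_max_left 1 m))).mono_set (by
        rw [uIcc_of_le hm, uIcc_of_le (zero_le_one.trans (le_max_left 1 m))]
        exact Icc_subset_Icc_right (le_max_right 1 m))
  exact (key u).symm.trans (key v)

/-- Remark 4.3: necessity of the Osgood condition. If `∫₀¹ dt/φ(t) < ∞`,
there is a nonconstant classical solution of `H'' + φ(|H'|) = 0` attaining a positive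
interior maximum, violating the strong maximum principle and the Hopf lemma. -/
theorem osgood_condition_necessary
    (φ : ℝ → ℝ) (hcont : ContinuousOn φ (Ici 0)) (hmono : StrictMonoOn φ (Ici 0))
    (hφ0 : φ 0 = 0) (hge : ∀ t : ℝ, 0 ≤ t → t ≤ φ t)
    (hfail : IntegrableOn (fun t => 1 / φ t) (Ioc (0:ℝ) 1)) :
    ∃ δ : ℝ, 0 < δ ∧ δ ≤ 1 ∧ ∃ H : ℝ → ℝ,
      (∃ x ∈ Ioo (-1:ℝ) δ, ∃ x' ∈ Ioo (-1:ℝ) δ, H x ≠ H x') ∧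
      ContDiffOn ℝ 1 H (Ioo (-1:ℝ) δ) ∧
      (∀ x ∈ Ioo (-1:ℝ) δ, DifferentiableAt ℝ H x ∧
        HasDerivAt (deriv H) (-φ |deriv H x|) x) ∧
      (∀ x ∈ Ioc (-1:ℝ) 0, H x = 1) ∧
      StrictAntiOn H (Ico (0:ℝ) δ) := by
  have hpos : ∀ t, 0 < t → 0 < φ t := fun t ht => ht.trans_le (hge t ht.le)
  set Φ : ℝ → ℝ := fun t => φ (max 0 (min t 1)) with hΦ
  have hclip : ∀ t : ℝ, 0 ≤ t → t ≤ 1 → Φ t = φ t := fun t h0 h1 => by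
    simp only [hΦ, min_eq_left h1, max_eq_right h0]
  have hΦc : Continuous Φ := hcont.comp_continuous (by fun_prop) fun t =>
    mem_Ici.2 (le_max_left _ _)
  have hΦ0 : Φ 0 = 0 := by rw [hclip 0 le_rfl zero_le_one, hφ0]
  have hΦpos : ∀ t, 0 < t → 0 < Φ t := fun t ht =>
    hpos _ (lt_max_of_lt_right (lt_min ht zero_lt_one))
  have hΦle : ∀ t, Φ t ≤ φ 1 := fun t =>
    hmono.monotoneOn (mem_Ici.2 (le_max_left _ _)) (mem_Ici.2 zero_le_one)
      (max_le zero_le_one (min_le_right _ _))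
  have hφ1 : 1 ≤ φ 1 := hge 1 zero_le_one
  set ψ : ℝ → ℝ := fun t => if t ≤ 0 then 1 else (Φ t)⁻¹ with hψ
  have hψpos : ∀ t, 0 < t → ψ t = (Φ t)⁻¹ := fun t ht => if_neg ht.not_ge
  have hint : ∀ a b, IntervalIntegrable ψ volume a b :=
    intervalIntegrable_of_constant_extension (a := 1) (b := (φ 1)⁻¹) (fun t ht => if_pos ht)
      (hfail.congr_fun (fun t ht => by
        rw [hψpos t ht.1, hclip t ht.1.le ht.2]; exact one_div _) measurableSet_Ioc)
      (fun t ht => by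
        rw [hψpos t (zero_lt_one.trans ht)]
        simp only [hΦ, min_eq_right ht.le, max_eq_right (zero_le_one (α := ℝ))])
  have hcψ : ∀ t, (φ 1)⁻¹ ≤ ψ t := by
    intro t
    rcases le_or_gt t 0 with ht | ht
    · rw [show ψ t = 1 from if_pos ht]
      exact inv_le_one_of_one_le₀ hφ1
    · rw [hψpos t ht]
      exact inv_anti₀ (hΦpos t ht) (hΦle t)
  obtain ⟨h, hd, hzero, hhpos, T, hT, hle⟩ := exists_hasDerivAt_leaving_zero Φ ψ hΦc hΦ0 hψpos
    hΦpos (φ 1)⁻¹ (inv_pos.2 (hpos 1 zero_lt_one)) hcψ hint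
  have hhc : Continuous h := continuous_iff_continuousAt.2 fun x => (hd x).continuousAt
  have hnn : ∀ x, 0 ≤ h x := fun x =>
    (le_or_gt x 0).elim (fun hx => (hzero x hx).ge) fun hx => (hhpos x hx).le
  set H : ℝ → ℝ := fun x => 1 - ∫ s in (0 : ℝ)..x, h s with hH
  have hHd : ∀ x, HasDerivAt H (-h x) x := fun x =>
    (hhc.integral_hasStrictDerivAt 0 x).hasDerivAt.const_sub 1
  have hderiv : deriv H = fun x => -h x := funext fun x => (hHd x).deriv
  have hHdiff : Differentiable ℝ H := fun x => (hHd x).differentiableAt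
  have hanti : StrictAntiOn H (Ico 0 (min 1 T)) := by
    refine strictAntiOn_of_deriv_neg (convex_Ico _ _) hHdiff.continuous.continuousOn ?_
    intro x hx
    rw [interior_Ico] at hx
    rw [hderiv]
    exact neg_neg_of_pos (hhpos x hx.1)
  have hδ : 0 < min 1 T := lt_min zero_lt_one hT
  refine ⟨min 1 T, hδ, min_le_left _ _, H, ⟨0, ⟨by norm_num, hδ⟩, min 1 T / 2,
    ⟨by linarith, by linarith⟩, ?_⟩, ?_, ?_, ?_, hanti⟩
  · exact (hanti ⟨le_rfl, hδ⟩ ⟨by linarith, by linarith⟩ (by linarith)).ne'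
  · refine (contDiff_one_iff_deriv.2 ⟨hHdiff, ?_⟩).contDiffOn
    rw [hderiv]
    exact hhc.neg
  · intro x hx
    refine ⟨hHdiff x, ?_⟩
    rw [hderiv]
    simp only [abs_neg, abs_of_nonneg (hnn x)]
    rw [← hclip (h x) (hnn x) (hle x (hx.2.le.trans (min_le_right _ _)))]
    exact (hd x).neg
  · intro x hx
    have : ∫ s in (0 : ℝ)..x, h s = ∫ _ in (0 : ℝ)..x, (0 : ℝ) := by
      refine intervalIntegral.integral_congr fun s hs => ?_
      rw [uIcc_of_ge hx.2] at hs
      exact hzero s hs.2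
    simp [hH, this]
end
end

section
/- Necessity of condition (φ_B): let φ : [0,∞) → [0,∞) be continuous, strictly increasing with φ(t) ≥ t for all t, and suppose (φ_B) fails, i.e. there exist ε > 0 and C < ∞ such that for every ν > 0 the solution f_ν : [0,ε] → [0,∞) of f′ = −φ(f), f(0) = ν satisfies ∫₀^ε f_ν(t) dt ≤ C. Then for each ν > 0 the function F_ν(x) = ∫₀ˣ f_ν(t) dt is twice differentiable on (0,ε) and satisfies F_ν″(x) + φ(|F_ν′(x)|) = 0 for all x ∈ (0,ε), with 0 ≤ F_ν ≤ C on [0,ε], F_ν(0) = 0 and right derivative F_ν′(0) = ν. In particular, this family of uniformly bounded classical solutions vanishing at x = 0 has arbitrarily large derivative at 0 as ν → ∞, so no upper bound of the form F_ν(x) ≤ c·x with c independent of ν can hold. -/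
open Metric Set Filter MeasureTheory
open scoped Topology RealInnerProductSpace Classical

noncomputable section

variable {n : ℕ}

/-- Remark 5.4: necessity of condition (φ_B). If (φ_B) fails, then the
primitives `F_ν(x) = ∫₀ˣ f_ν` of the solutions of `f' = -φ(f)`, `f(0) = ν`, form a family
of uniformly bounded classical solutions of `F'' + φ(|F'|) = 0` vanishing at `0` with
arbitrarily large derivative `ν` at `0`, so no bound `F_ν(x) ≤ c·x` uniform in `ν` holds. -/
theorem phiB_necessary
    (φ : ℝ → ℝ) (hφ : PhiAdmissible φ)
    (ε C : ℝ) (hε : 0 < ε)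
    (hfail : ∀ ν : ℝ, 0 < ν → ∀ f : ℝ → ℝ,
      (∀ t ∈ Icc (0:ℝ) ε, 0 ≤ f t) → f 0 = ν →
      (∀ t ∈ Icc (0:ℝ) ε, HasDerivAt f (-φ (f t)) t) →
      (∫ t in (0:ℝ)..ε, f t) ≤ C) :
    ∀ ν : ℝ, 0 < ν → ∀ f : ℝ → ℝ,
      (∀ t ∈ Icc (0:ℝ) ε, 0 ≤ f t) → f 0 = ν →
      (∀ t ∈ Icc (0:ℝ) ε, HasDerivAt f (-φ (f t)) t) →
      (∀ x ∈ Ioo (0:ℝ) ε, HasDerivAt (fun s => ∫ t in (0:ℝ)..s, f t) (f x) x ∧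
        HasDerivAt f (-φ |f x|) x) ∧
      (∀ x ∈ Icc (0:ℝ) ε, 0 ≤ (∫ t in (0:ℝ)..x, f t) ∧ (∫ t in (0:ℝ)..x, f t) ≤ C) ∧
      (∫ t in (0:ℝ)..(0:ℝ), f t) = 0 ∧
      HasDerivWithinAt (fun s => ∫ t in (0:ℝ)..s, f t) ν (Ici 0) 0 ∧
      (∀ c : ℝ, c < ν → ∃ x ∈ Ioo (0:ℝ) ε, c * x < ∫ t in (0:ℝ)..x, f t) := by
  intro ν hν f hf0 hfν hfd
  have hcont : ContinuousOn f (Icc 0 ε) := fun t ht => (hfd t ht).continuousAt.continuousWithinAt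
  have hint : ∀ a ∈ Icc (0:ℝ) ε, ∀ b ∈ Icc (0:ℝ) ε, IntervalIntegrable f volume a b :=
    fun a ha b hb => (hcont.mono (uIcc_subset_Icc ha hb)).intervalIntegrable
  have h0 : (0:ℝ) ∈ Icc (0:ℝ) ε := ⟨le_rfl, hε.le⟩
  have hε' : ε ∈ Icc (0:ℝ) ε := ⟨hε.le, le_rfl⟩
  have hderiv : HasDerivWithinAt (fun s => ∫ t in (0:ℝ)..s, f t) ν (Ici 0) 0 := by
    rw [← hfν]
    refine intervalIntegral.integral_hasDerivWithinAt_right (t := Ioi 0) (hint 0 h0 0 h0) ?_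
      (hfd 0 h0).continuousAt.continuousWithinAt
    refine ⟨Icc 0 ε, ?_, hcont.aestronglyMeasurable measurableSet_Icc⟩
    exact mem_of_superset (Ioo_mem_nhdsGT hε) Ioo_subset_Icc_self
  refine ⟨fun x hx => ⟨?_, ?_⟩, fun x hx => ⟨?_, ?_⟩, intervalIntegral.integral_same, hderiv, ?_⟩
  · have hx' := Ioo_subset_Icc_self hx
    exact intervalIntegral.integral_hasDerivAt_right (hint 0 h0 x hx')
      ⟨Icc 0 ε, Icc_mem_nhds hx.1 hx.2, hcont.aestronglyMeasurable measurableSet_Icc⟩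
      (hfd x hx').continuousAt
  · have hx' := Ioo_subset_Icc_self hx
    rw [abs_of_nonneg (hf0 x hx')]
    exact hfd x hx'
  · exact intervalIntegral.integral_nonneg hx.1 fun t ht => hf0 t ⟨ht.1, ht.2.trans hx.2⟩
  · have htail : 0 ≤ ∫ t in x..ε, f t :=
      intervalIntegral.integral_nonneg hx.2 fun t ht => hf0 t ⟨hx.1.trans ht.1, ht.2⟩
    have hadd := intervalIntegral.integral_add_adjacent_intervals
      (hint 0 h0 x hx) (hint x hx ε hε')
    linarith [hfail ν hν f hf0 hfν hfd]
  · intro c hc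
    have hslope := (hasDerivWithinAt_iff_tendsto_slope' self_notMem_Ioi).1 hderiv.Ioi_of_Ici
    obtain ⟨x, hcx, hx⟩ := ((hslope.eventually_const_lt hc).and (Ioo_mem_nhdsGT hε)).exists
    refine ⟨x, hx, ?_⟩
    rw [slope_def_field, intervalIntegral.integral_same, sub_zero, sub_zero,
      lt_div_iff₀ hx.1] at hcx
    exact hcx
end
end
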